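/- Let n ≥ 11. There is no irreducible representation C_1, …, C_{n−1} ∈ GL_r(ℂ) of B_n of dimension r ≥ n+1 such that, with A_i = C_i − I (indices in ℤ_n as below), rank(A_1) = 3, dim(Im A_i ∩ Im A_{i+1}) = 0 for all i ∈ ℤ_n, and dim(Im A_i ∩ Im A_j) = 1 for all i, j ∈ ℤ_n with ||i−j|| ≥ 2. -/

import Mathlib

section Aux

variable {V : Type*} [AddCommGroup V] [Module ℂ V]

lemma aux_mem_of_comm (M N : Module.End ℂ V) (h : M * N = N * M) {x : V}
    (hx : x ∈ LinearMap.range N) : M x ∈ LinearMap.range N := by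
  obtain ⟨y, rfl⟩ := hx
  exact ⟨M y, (LinearMap.congr_fun h y).symm⟩

lemma aux_mem_of_conj (g N N' : Module.End ℂ V) (h : g * N = N' * g) {x : V}
    (hx : x ∈ LinearMap.range N) : g x ∈ LinearMap.range N' := by
  obtain ⟨y, rfl⟩ := hx
  exact ⟨g y, (LinearMap.congr_fun h y).symm⟩

lemma aux_inv_conj {R : Type*} [Ring R] {g g' N N' : R} (h1 : g * g' = 1) (h2 : g' * g = 1)
    (h : g * N = N' * g) : g' * N' = N * g' := by
  calc g' * N' = g' * N' * (g * g') := by rw [h1, mul_one]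
    _ = g' * (N' * g) * g' := by noncomm_ring
    _ = (g' * g) * N * g' := by rw [← h]; noncomm_ring
    _ = N * g' := by rw [h2, one_mul]

/-- a nonzero common vector of three images -/
def auxQ (B : ℕ → Module.End ℂ V) (j k : ℕ) : Prop :=
  ∃ x : V, x ≠ 0 ∧ x ∈ LinearMap.range (B 0) ∧ x ∈ LinearMap.range (B j) ∧
    x ∈ LinearMap.range (B k)

lemma aux_inj {g g' : Module.End ℂ V} (h2 : g' * g = 1) {x : V} (hx : x ≠ 0) : g x ≠ 0 := by
  intro h
  apply hx
  have := LinearMap.congr_fun h2 x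
  simpa [h] using this.symm

lemma auxQ_move (B : ℕ → Module.End ℂ V) (g g' : Module.End ℂ V) (h2 : g' * g = 1)
    (j k j' k' : ℕ) (h0 : g * B 0 = B 0 * g) (hj : g * B j = B j' * g)
    (hk : g * B k = B k' * g) (hQ : auxQ B j k) : auxQ B j' k' := by
  obtain ⟨x, hx, a, b, c⟩ := hQ
  exact ⟨g x, aux_inj h2 hx, aux_mem_of_conj g _ _ h0 a, aux_mem_of_conj g _ _ hj b,
    aux_mem_of_conj g _ _ hk c⟩

variable [FiniteDimensional ℂ V]

lemma aux_main (n : ℕ) (hn : 11 ≤ n) (B : ℕ → Module.End ℂ V)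
    (hcomm : ∀ i j, i + 2 ≤ j → j + 2 ≤ n + i → j < n → B i * B j = B j * B i)
    (hg : ∀ i, i + 1 < n → ∃ g g' : Module.End ℂ V, g * g' = 1 ∧ g' * g = 1 ∧
      g * B i = B (i + 1) * g ∧
      ∀ M, M * B i = B i * M → M * B (i + 1) = B (i + 1) * M → g * M = M * g)
    (h0 : ∀ i x, i + 1 < n → x ∈ LinearMap.range (B i) → x ∈ LinearMap.range (B (i + 1)) → x = 0)
    (h1 : ∀ i j, i + 2 ≤ j → j + 2 ≤ n + i → j < n →
      Module.finrank ℂ ↥(LinearMap.range (B i) ⊓ LinearMap.range (B j)) = 1)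
    (hrank : Module.finrank ℂ (LinearMap.range (B 0)) = 3)
    (j k : ℕ) (hj : 2 ≤ j) (hj' : j + 2 ≤ n) (hk : 2 ≤ k) (hk' : k + 2 ≤ n)
    (x : V) (hx0 : x ∈ LinearMap.range (B 0)) (hxj : x ∈ LinearMap.range (B j)) :
    B k x = 0 := by
  have stepk : ∀ j k, 2 ≤ j → j + 2 ≤ k → k + 3 ≤ n → (auxQ B j k ↔ auxQ B j (k + 1)) := by
    intro j k a b c
    obtain ⟨g, g', e1, e2, e3, e4⟩ := hg k (by omega)
    have c0 := e4 (B 0) (hcomm _ _ (by omega) (by omega) (by omega))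
      (hcomm _ _ (by omega) (by omega) (by omega))
    have cj := e4 (B j) (hcomm _ _ (by omega) (by omega) (by omega))
      (hcomm _ _ (by omega) (by omega) (by omega))
    exact ⟨auxQ_move B g g' e2 _ _ _ _ c0 cj e3,
      auxQ_move B g' g e1 _ _ _ _ (aux_inv_conj e1 e2 c0) (aux_inv_conj e1 e2 cj)
        (aux_inv_conj e1 e2 e3)⟩
  have stepj : ∀ j k, 2 ≤ j → j + 3 ≤ k → k + 2 ≤ n → (auxQ B j k ↔ auxQ B (j + 1) k) := by
    intro j k a b c
    obtain ⟨g, g', e1, e2, e3, e4⟩ := hg j (by omega)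
    have c0 := e4 (B 0) (hcomm _ _ (by omega) (by omega) (by omega))
      (hcomm _ _ (by omega) (by omega) (by omega))
    have ck := e4 (B k) (hcomm _ _ (by omega) (by omega) (by omega)).symm
      (hcomm _ _ (by omega) (by omega) (by omega)).symm
    exact ⟨auxQ_move B g g' e2 _ _ _ _ c0 e3 ck,
      auxQ_move B g' g e1 _ _ _ _ (aux_inv_conj e1 e2 c0) (aux_inv_conj e1 e2 e3)
        (aux_inv_conj e1 e2 ck)⟩
  have hQ24 : ¬ auxQ B 2 4 := by
    intro h
    have h25 := (stepk 2 4 (by omega) (by omega) (by omega)).1 h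
    have h35 := (stepj 2 5 (by omega) (by omega) (by omega)).1 h25
    obtain ⟨x, hx, x0, x2, x5⟩ := h25
    obtain ⟨y, hy, y0, y3, y5⟩ := h35
    have hf := h1 0 5 (by omega) (by omega) (by omega)
    obtain ⟨c, hc⟩ := (finrank_eq_one_iff_of_nonzero' (⟨y, y0, y5⟩ :
      ↥(LinearMap.range (B 0) ⊓ LinearMap.range (B 5))) (fun h => hy (congrArg Subtype.val h))).1 hf ⟨x, x0, x5⟩
    have hc' : c • y = x := congrArg Subtype.val hc
    exact hx (h0 2 x (by omega) x2 (hc' ▸ Submodule.smul_mem _ c y3))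
  have hQ2 : ∀ k, 4 ≤ k → k + 2 ≤ n → ¬ auxQ B 2 k := by
    intro k hk
    induction k, hk using Nat.le_induction with
    | base => intro _; exact hQ24
    | succ k hk ih =>
      intro hle
      rw [← stepk 2 k (by omega) (by omega) (by omega)]
      exact ih (by omega)
  have hQ : ∀ j k, 2 ≤ j → j + 2 ≤ k → k + 2 ≤ n → ¬ auxQ B j k := by
    intro j k hj
    induction j, hj using Nat.le_induction with
    | base => intro a b; exact hQ2 k a b
    | succ j hj ih =>
      intro a b
      rw [← stepj j k (by omega) (by omega) (by omega)]
      exact ih (by omega) (by omega)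
  -- nonadjacent case
  have far : ∀ j k, 2 ≤ j → j + 2 ≤ n → 2 ≤ k → k + 2 ≤ n → (j + 2 ≤ k ∨ k + 2 ≤ j) →
      ∀ x, x ∈ LinearMap.range (B 0) → x ∈ LinearMap.range (B j) → B k x = 0 := by
    intro j k hj hj' hk hk' hjk x hx0 hxj
    by_contra hne
    have m0 := aux_mem_of_comm (B k) (B 0) (hcomm _ _ (by omega) (by omega) (by omega)).symm hx0
    have mk : B k x ∈ LinearMap.range (B k) := ⟨x, rfl⟩
    rcases hjk with hjk | hjk
    · have mj := aux_mem_of_comm (B k) (B j) (hcomm _ _ (by omega) (by omega) (by omega)).symm hxj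
      exact hQ j k hj hjk hk' ⟨_, hne, m0, mj, mk⟩
    · have mj := aux_mem_of_comm (B k) (B j) (hcomm _ _ (by omega) (by omega) (by omega)) hxj
      exact hQ k j hk hjk hj' ⟨_, hne, m0, mk, mj⟩
  -- annihilation of V_0 is independent of k
  have kill : ∀ k, 2 ≤ k → k + 2 ≤ n → (B k * B 0 = 0 ↔ B 2 * B 0 = 0) := by
    intro k hk
    induction k, hk using Nat.le_induction with
    | base => intro _; rfl
    | succ k hk ih =>
      intro hle
      rw [← ih (by omega)]
      obtain ⟨g, g', e1, e2, e3, e4⟩ := hg k (by omega)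
      have c0 := e4 (B 0) (hcomm _ _ (by omega) (by omega) (by omega))
        (hcomm _ _ (by omega) (by omega) (by omega))
      have key : g * (B k * B 0) = (B (k + 1) * B 0) * g := by
        rw [← mul_assoc, e3, mul_assoc, c0, mul_assoc]
      constructor
      · intro h
        rw [h, zero_mul] at key
        calc B k * B 0 = (g' * g) * (B k * B 0) := by rw [e2, one_mul]
          _ = 0 := by rw [mul_assoc, key, mul_zero]
      · intro h
        rw [h, mul_zero] at key
        calc B (k+1) * B 0 = (B (k+1) * B 0) * (g * g') := by rw [e1, mul_one]
          _ = 0 := by rw [← mul_assoc, ← key, zero_mul]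
  have exv : ∀ a, 2 ≤ a → a + 2 ≤ n → ∃ e : V, e ≠ 0 ∧ e ∈ LinearMap.range (B 0) ∧
      e ∈ LinearMap.range (B a) := by
    intro a ha ha'
    obtain ⟨v, hv, -⟩ := finrank_eq_one_iff'.1 (h1 0 a (by omega) (by omega) (by omega))
    exact ⟨v, by simpa using hv, v.2.1, v.2.2⟩
  by_cases hjk : j + 2 ≤ k ∨ k + 2 ≤ j
  · exact far j k hj hj' hk hk' hjk x hx0 hxj
  have hidx : ∃ a k', 2 ≤ a ∧ a + 3 ≤ n ∧ 2 ≤ k' ∧ k' + 2 ≤ n ∧ (a + 3 ≤ k ∨ k + 2 ≤ a) ∧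
      (a + 3 ≤ k' ∨ k' + 2 ≤ a) ∧ (j + 2 ≤ k' ∨ k' + 2 ≤ j) := by
    by_cases h5 : k ≤ 5
    · by_cases h4 : 4 ≤ j
      · exact ⟨8, 2, by omega⟩
      · exact ⟨8, 6, by omega⟩
    · by_cases h7 : 7 ≤ j
      · exact ⟨2, 5, by omega⟩
      · exact ⟨2, 9, by omega⟩
  obtain ⟨a, k', ha, ha', hk2, hk2', hak, hak', hjk'⟩ := hidx
  obtain ⟨u, hu, u0, ua⟩ := exv a ha (by omega)
  obtain ⟨w, hw, w0, wb⟩ := exv (a + 1) (by omega) (by omega)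
  have ku := far a k (by omega) (by omega) hk hk' (by omega) u u0 ua
  have kw := far (a+1) k (by omega) (by omega) hk hk' (by omega) w w0 wb
  have ku' := far a k' (by omega) (by omega) hk2 hk2' (by omega) u u0 ua
  have kw' := far (a+1) k' (by omega) (by omega) hk2 hk2' (by omega) w w0 wb
  have kx' := far j k' (by omega) (by omega) hk2 hk2' (by omega) x hx0 hxj
  have hli2 : LinearIndependent ℂ ![u, w] := by
    rw [LinearIndependent.pair_iff' hu]
    intro c hc
    exact hw (h0 a w (by omega) (hc ▸ Submodule.smul_mem _ c ua) wb)
  by_cases hxs : x ∈ Submodule.span ℂ (Set.range ![u, w])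
  · have : Submodule.span ℂ (Set.range ![u, w]) ≤ LinearMap.ker (B k) := by
      rw [Submodule.span_le]
      rintro _ ⟨i, rfl⟩
      fin_cases i
      · simpa using ku
      · simpa using kw
    exact this hxs
  · have hli3 : LinearIndependent ℂ ![x, u, w] := by
      exact linearIndependent_finCons.2 ⟨hli2, hxs⟩
    have hle : Submodule.span ℂ (Set.range ![x, u, w]) ≤ LinearMap.range (B 0) := by
      rw [Submodule.span_le]
      rintro _ ⟨i, rfl⟩
      fin_cases i
      · exact hx0
      · exact u0
      · exact w0
    have heq := Submodule.eq_of_le_of_finrank_eq hle (by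
      rw [finrank_span_eq_card hli3, hrank]; simp)
    have hker : Submodule.span ℂ (Set.range ![x, u, w]) ≤ LinearMap.ker (B k') := by
      rw [Submodule.span_le]
      rintro _ ⟨i, rfl⟩
      fin_cases i
      · exact kx'
      · exact ku'
      · exact kw'
    have hz : B k' * B 0 = 0 := by
      ext y
      have : B 0 y ∈ LinearMap.range (B 0) := ⟨y, rfl⟩
      rw [← heq] at this
      exact hker this
    have hz2 := (kill k hk hk').2 ((kill k' hk2 hk2').1 hz)
    obtain ⟨y, rfl⟩ := hx0
    exact LinearMap.congr_fun hz2 y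

end Aux

section AuxT

variable {R : Type*} [Ring R]

/-- partial products -/
def auxProd (C : ℕ → R) (m : ℕ) : R := (List.map (fun i => C (i + 1)) (List.range m)).prod

lemma auxProd_succ (C : ℕ → R) (m : ℕ) : auxProd C (m + 1) = auxProd C m * C (m + 1) := by
  simp [auxProd, List.range_succ]

/-- the product of C 1..C m commutes with C k for k far -/
lemma auxProd_comm (C : ℕ → R) (n : ℕ)
    (hcomm : ∀ i j, 1 ≤ i → i ≤ n - 1 → 1 ≤ j → j ≤ n - 1 → i + 2 ≤ j → C i * C j = C j * C i)
    (m k : ℕ) (hmk : m + 2 ≤ k) (hk : k ≤ n - 1) : auxProd C m * C k = C k * auxProd C m := by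
  induction m with
  | zero => simp [auxProd]
  | succ m ih =>
    rw [auxProd_succ, mul_assoc, hcomm (m+1) k (by omega) (by omega) (by omega) hk (by omega),
      ← mul_assoc, ih (by omega), mul_assoc]

lemma auxProd_shift (C : ℕ → R) (n : ℕ)
    (hcomm : ∀ i j, 1 ≤ i → i ≤ n - 1 → 1 ≤ j → j ≤ n - 1 → i + 2 ≤ j → C i * C j = C j * C i)
    (hbraid : ∀ i, 1 ≤ i → i ≤ n - 2 →
      C i * C (i + 1) * C i = C (i + 1) * C i * C (i + 1))
    (m : ℕ) (hm : m ≤ n - 1) (k : ℕ) (hk : 1 ≤ k) (hkm : k + 1 ≤ m) :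
    auxProd C m * C k = C (k + 1) * auxProd C m := by
  induction m, hkm using Nat.le_induction with
  | base =>
    obtain ⟨l, rfl⟩ : ∃ l, k = l + 1 := ⟨k - 1, by omega⟩
    rw [auxProd_succ, auxProd_succ]
    have h1 := auxProd_comm C n hcomm l (l + 1 + 1) (by omega) hm
    have h2 := hbraid (l + 1) (by omega) (by omega)
    calc auxProd C l * C (l + 1) * C (l + 1 + 1) * C (l + 1)
        = auxProd C l * (C (l + 1) * C (l + 1 + 1) * C (l + 1)) := by noncomm_ring
      _ = (auxProd C l * C (l + 1 + 1)) * C (l + 1) * C (l + 1 + 1) := by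
        rw [h2]; noncomm_ring
      _ = _ := by rw [h1]; noncomm_ring
  | succ m hkm ih =>
    rw [auxProd_succ, mul_assoc,
      ← hcomm k (m+1) (by omega) (by omega) (by omega) (by omega) (by omega),
      ← mul_assoc, ih (by omega), mul_assoc]

/-- product of the shifted generators C 2 .. C (m+1) -/
lemma auxProd_cons (C : ℕ → R) (m : ℕ) :
    auxProd C (m + 1) = C 1 * auxProd (fun i => C (i + 1)) m := by
  induction m with
  | zero => simp [auxProd]
  | succ m ih => rw [auxProd_succ, ih, auxProd_succ, mul_assoc]

lemma auxProd_T (C : ℕ → R) (T : R) (m : ℕ) (h : ∀ k, 1 ≤ k → k ≤ m → T * C k = C (k + 1) * T) :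
    T * auxProd C m = auxProd (fun i => C (i + 1)) m * T := by
  induction m with
  | zero => simp [auxProd]
  | succ m ih =>
    rw [auxProd_succ, ← mul_assoc, ih (fun k a b => h k a (by omega)), mul_assoc,
      h (m+1) (by omega) le_rfl, auxProd_succ, mul_assoc]

lemma auxProd_last (C : ℕ → R) (m : ℕ)
    (h : ∀ k, 1 ≤ k → k ≤ m → auxProd C (m+1) * C k = C (k + 1) * auxProd C (m+1)) :
    C 1 * auxProd C (m+1) * auxProd C (m+1) = auxProd C (m+1) * auxProd C (m+1) * C (m+1) := by
  have hs := auxProd_T C (auxProd C (m+1)) m h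
  calc C 1 * auxProd C (m+1) * auxProd C (m+1)
      = C 1 * (auxProd C (m+1) * auxProd C m) * C (m+1) := by
        conv_lhs => rw [mul_assoc, auxProd_succ C m]
        rw [auxProd_succ]; noncomm_ring
    _ = (C 1 * auxProd (fun i => C (i + 1)) m) * auxProd C (m+1) * C (m+1) := by
        rw [hs]; noncomm_ring
    _ = _ := by rw [← auxProd_cons]

lemma auxProd_unit (C : ℕ → R) (m : ℕ) (h : ∀ k, 1 ≤ k → k ≤ m → IsUnit (C k)) :
    IsUnit (auxProd C m) := by
  induction m with
  | zero => simp [auxProd]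
  | succ m ih =>
    rw [auxProd_succ]
    exact (ih (fun k a b => h k a (by omega))).mul (h _ (by omega) le_rfl)

end AuxT

lemma aux_final {V : Type*} [AddCommGroup V] [Module ℂ V] [FiniteDimensional ℂ V]
    (n : ℕ) (hn : 11 ≤ n) (A : ZMod n → Module.End ℂ V) (T T' : Module.End ℂ V)
    (hT1 : T * T' = 1) (hT2 : T' * T = 1) (hTA : ∀ i, T * A i = A (i + 1) * T)
    (hcomm : ∀ d : ℕ, 2 ≤ d → d + 2 ≤ n → A 1 * A (1 + (d : ZMod n)) = A (1 + (d : ZMod n)) * A 1)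
    (hunit : IsUnit (1 + A 1))
    (hbraid : (1 + A 1) * (1 + A (1 + 1)) * (1 + A 1) =
      (1 + A (1 + 1)) * (1 + A 1) * (1 + A (1 + 1)))
    (hrank : Module.finrank ℂ (LinearMap.range (A 1)) = 3)
    (h0 : ∀ i x, x ∈ LinearMap.range (A i) → x ∈ LinearMap.range (A (i + 1)) → x = 0)
    (h1 : ∀ (i : ZMod n) (d : ℕ), 2 ≤ d → d + 2 ≤ n →
      Module.finrank ℂ ↥(LinearMap.range (A i) ⊓ LinearMap.range (A (i + d))) = 1) :
    ∃ x : V, x ≠ 0 ∧ ∀ i, A i x = 0 := by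
  have : NeZero n := ⟨by omega⟩
  have ind : ∀ P : ZMod n → Prop, P 1 → (∀ i, P i → P (i + 1)) → ∀ i, P i := by
    intro P hP hs i
    have : ∀ m : ℕ, P (1 + m) := by
      intro m
      induction m with
      | zero => simpa using hP
      | succ m ih => have := hs _ ih; rwa [add_assoc, ← Nat.cast_succ] at this
    have h := this (i - 1).val
    rwa [ZMod.natCast_zmod_val, add_sub_cancel] at h
  have hA' : ∀ i, A (i + 1) = T * A i * T' := fun i => by
    rw [hTA, mul_assoc, hT1, mul_one]
  have hcan : ∀ X Y : Module.End ℂ V, T * X * T' * (T * Y * T') = T * (X * Y) * T' := by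
    intro X Y
    calc T * X * T' * (T * Y * T') = T * X * (T' * T) * Y * T' := by noncomm_ring
      _ = _ := by rw [hT2]; noncomm_ring
  have hC' : ∀ i, 1 + A (i + 1) = T * (1 + A i) * T' := fun i => by
    rw [hA', mul_add, add_mul, mul_one, hT1]
  have comm : ∀ (d : ℕ), 2 ≤ d → d + 2 ≤ n → ∀ i, A i * A (i + d) = A (i + d) * A i := by
    intro d hd hd'
    apply ind
    · exact hcomm d hd hd'
    · intro i hi
      rw [add_right_comm, hA', hA', hcan, hcan, hi]
  have unit : ∀ i, IsUnit (1 + A i) := by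
    apply ind
    · exact hunit
    · intro i hi
      rw [hC']
      exact (IsUnit.mul ⟨⟨T, T', hT1, hT2⟩, rfl⟩ hi).mul ⟨⟨T', T, hT2, hT1⟩, rfl⟩
  have braid : ∀ i, (1 + A i) * (1 + A (i + 1)) * (1 + A i) =
      (1 + A (i + 1)) * (1 + A i) * (1 + A (i + 1)) := by
    apply ind
    · exact hbraid
    · intro i hi
      rw [hC' (i + 1), hC' i, hcan, hcan, hcan, hcan, ← hC' i, hi]
  have rank : ∀ i, Module.finrank ℂ (LinearMap.range (A i)) = 3 := by
    apply ind
    · exact hrank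
    · intro i hi
      let e : V ≃ₗ[ℂ] V := LinearEquiv.ofLinearMap T T' hT1 hT2
      have : LinearMap.range (A (i + 1)) = (LinearMap.range (A i)).map (e : V →ₗ[ℂ] V) := by
        apply le_antisymm
        · rintro _ ⟨y, rfl⟩
          rw [hA']
          exact ⟨A i (T' y), ⟨_, rfl⟩, rfl⟩
        · rintro _ ⟨_, ⟨y, rfl⟩, rfl⟩
          exact ⟨T y, (LinearMap.congr_fun (hTA i) y).symm⟩
      rw [this, LinearEquiv.finrank_map_eq, hi]
  have key : ∀ (c : ZMod n) (j k : ℕ), 2 ≤ j → j + 2 ≤ n → 2 ≤ k → k + 2 ≤ n → ∀ x,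
      x ∈ LinearMap.range (A c) → x ∈ LinearMap.range (A (c + j)) → A (c + k) x = 0 := by
    intro c j k hj hj' hk hk' x hx hxj
    refine aux_main n hn (fun m => A (c + m)) ?_ ?_ ?_ ?_ ?_ j k hj hj' hk hk' x
      (by simpa using hx) hxj
    · intro i j hij hji hj
      obtain ⟨d, rfl⟩ := Nat.exists_eq_add_of_le (show i ≤ j by omega)
      have := comm d (by omega) (by omega) (c + i)
      simpa [add_assoc] using this
    · intro i hi
      obtain ⟨p, hp⟩ := unit (c + i)
      obtain ⟨q, hq⟩ := unit (c + i + 1)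
      have hb := braid (c + i)
      have hs : c + ((i + 1 : ℕ) : ZMod n) = c + i + 1 := by push_cast; ring
      refine ⟨(p * q : (Module.End ℂ V)ˣ), ((p * q)⁻¹ : (Module.End ℂ V)ˣ), Units.mul_inv _,
        Units.inv_mul _, ?_, ?_⟩
      · rw [Units.val_mul, hp, hq]
        simp only [hs]
        have e : (1 + A (c + i)) * (1 + A (c + i + 1)) * (1 + A (c + i)) -
          (1 + A (c + i)) * (1 + A (c + i + 1)) =
          (1 + A (c + i + 1)) * (1 + A (c + i)) * (1 + A (c + i + 1)) -
          (1 + A (c + i)) * (1 + A (c + i + 1)) := by rw [hb]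
        calc _ = _ := by noncomm_ring
          _ = _ := e
          _ = _ := by noncomm_ring
      · intro M m1 m2
        simp only [hs] at m1 m2
        rw [Units.val_mul, hp, hq]
        have c1 : Commute M (A (c + i)) := m1
        have c2 : Commute M (A (c + i + 1)) := m2
        exact (((Commute.one_right M).add_right c1).mul_right
          ((Commute.one_right M).add_right c2)).symm
    · intro i x hi a b
      refine h0 (c + i) x a ?_
      have hs : c + ((i + 1 : ℕ) : ZMod n) = c + i + 1 := by push_cast; ring
      simpa only [hs] using b
    · intro i j hij hji hj
      obtain ⟨d, rfl⟩ := Nat.exists_eq_add_of_le (show i ≤ j by omega)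
      have := h1 (c + i) d (by omega) (by omega)
      have hs : c + ((i + d : ℕ) : ZMod n) = c + i + d := by push_cast; ring
      rw [← hs] at this
      exact this
    · have := rank (c + ((0 : ℕ) : ZMod n))
      exact this
  obtain ⟨v, hv, -⟩ := finrank_eq_one_iff'.1 (h1 0 4 (by omega) (by omega))
  have v0 : v.1 ∈ LinearMap.range (A 0) := v.2.1
  have v4 : v.1 ∈ LinearMap.range (A (0 + (4:ℕ))) := v.2.2
  obtain ⟨v, hvm⟩ := v
  simp only at v0 v4
  refine ⟨v, by simpa using hv, ?_⟩
  intro i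
  have hlt := ZMod.val_lt i
  have hi : ((i.val : ℕ) : ZMod n) = i := ZMod.natCast_zmod_val i
  by_cases hm : 2 ≤ i.val ∧ i.val + 2 ≤ n
  · have := key 0 4 i.val (by omega) (by omega) hm.1 hm.2 v v0 v4
    rwa [hi, zero_add] at this
  · rw [zero_add] at v4
    have hn0 : ((n : ℕ) : ZMod n) = 0 := ZMod.natCast_self n
    have back : (((4:ℕ) : ZMod n) + ((n - 4 : ℕ) : ZMod n)) = 0 := by
      rw [← Nat.cast_add, show 4 + (n - 4) = n by omega, hn0]
    have K := key ((4:ℕ) : ZMod n) (n - 4)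
    rw [back] at K
    have fin : ∀ k, 2 ≤ k → k + 2 ≤ n → (((4 + k : ℕ)) : ZMod n) = i → A i v = 0 := by
      intro k a b e
      have := K k (by omega) (by omega) a b v v4 v0
      rwa [← Nat.cast_add, e] at this
    by_cases hbig : i.val + 2 ≤ n
    · refine fin (n - 4 + i.val) (by omega) (by omega) ?_
      rw [show 4 + (n - 4 + i.val) = n + i.val by omega, Nat.cast_add, hn0, zero_add, hi]
    · refine fin (i.val - 4) (by omega) (by omega) ?_
      rw [show 4 + (i.val - 4) = i.val by omega, hi]

/-- For `n ≥ 11` there is no irreducible representation of `B_n` of dimension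
`r ≥ n+1` such that, with `A i = C i - 1` (`i ∈ ℤ_n`, `A 0 = T C_{n-1} T⁻¹ - 1`),
`rank (A 1) = 3`, `dim (Im A_i ∩ Im A_{i+1}) = 0` for all `i ∈ ℤ_n`, and
`dim (Im A_i ∩ Im A_j) = 1` whenever `‖i - j‖ ≥ 2`. -/
theorem stmt_19 (n r : ℕ) (hn : 11 ≤ n) (hr : n + 1 ≤ r)
    (C : ℕ → Matrix (Fin r) (Fin r) ℂ)
    (hinv : ∀ i, 1 ≤ i → i ≤ n - 1 → IsUnit (C i))
    (hcomm : ∀ i j, 1 ≤ i → i ≤ n - 1 → 1 ≤ j → j ≤ n - 1 → i + 2 ≤ j →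
      C i * C j = C j * C i)
    (hbraid : ∀ i, 1 ≤ i → i ≤ n - 2 →
      C i * C (i + 1) * C i = C (i + 1) * C i * C (i + 1))
    (hirr : ∀ p : Submodule ℂ (Fin r → ℂ),
      (∀ i, 1 ≤ i → i ≤ n - 1 → ∀ v ∈ p, (C i).mulVec v ∈ p) → p = ⊥ ∨ p = ⊤)
    (T : Matrix (Fin r) (Fin r) ℂ)
    (hT : T = (List.map (fun i => C (i + 1)) (List.range (n - 1))).prod)
    (A : ZMod n → Matrix (Fin r) (Fin r) ℂ)
    (hA : ∀ i : ℕ, 1 ≤ i → i ≤ n - 1 → A (i : ZMod n) = C i - 1)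
    (hA0 : A 0 = T * C (n - 1) * T⁻¹ - 1)
    (hrank : (A 1).rank = 3)
    (h0 : ∀ i : ZMod n,
      Module.finrank ℂ
        ↥(LinearMap.range (A i).mulVecLin ⊓
          LinearMap.range (A (i + 1)).mulVecLin) = 0)
    (h1 : ∀ i j : ZMod n, 2 ≤ min ((i - j).val) (n - (i - j).val) →
      Module.finrank ℂ
        ↥(LinearMap.range (A i).mulVecLin ⊓
          LinearMap.range (A j).mulVecLin) = 1) :
    False := by
  have : NeZero n := ⟨by omega⟩
  have hTP : T = auxProd C (n - 1) := hT
  obtain ⟨m, rfl⟩ : ∃ m, n = m + 2 := ⟨n - 2, by omega⟩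
  have e1 : m + 2 - 1 = m + 1 := by omega
  have e2 : m + 2 - 2 = m := by omega
  have hTk : ∀ k, 1 ≤ k → k ≤ m → T * C k = C (k + 1) * T := by
    intro k a b
    rw [hTP]
    exact auxProd_shift C (m + 2) hcomm hbraid _ le_rfl k a (by omega)
  have hTu : IsUnit T := by
    rw [hTP]; exact auxProd_unit C _ hinv
  rw [e1] at hTP hA0
  have hlast : C 1 * T * T = T * T * C (m + 1) := by
    have := auxProd_last C m (by rw [← hTP]; exact hTk)
    rwa [← hTP] at this
  have hdet : IsUnit T.det := (Matrix.isUnit_iff_isUnit_det T).1 hTu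
  have hT1 : T * T⁻¹ = 1 := Matrix.mul_nonsing_inv T hdet
  have hT2 : T⁻¹ * T = 1 := Matrix.nonsing_inv_mul T hdet
  have hn0 : ((m + 2 : ℕ) : ZMod (m + 2)) = 0 := ZMod.natCast_self _
  have hTA : ∀ i, T * A i = A (i + 1) * T := by
    intro i
    have hlt := ZMod.val_lt i
    have hi : ((i.val : ℕ) : ZMod (m + 2)) = i := ZMod.natCast_zmod_val i
    by_cases h0' : i.val = 0
    · rw [h0'] at hi
      have hi0 : i = 0 := by rw [← hi]; simp
      have hA1 := hA 1 le_rfl (by omega)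
      rw [Nat.cast_one] at hA1
      rw [hi0, zero_add, hA0, hA1]
      calc T * (T * C (m + 1) * T⁻¹ - 1) = (T * T * C (m + 1)) * T⁻¹ - T := by noncomm_ring
        _ = C 1 * T * (T * T⁻¹) - T := by rw [← hlast]; noncomm_ring
        _ = (C 1 - 1) * T := by rw [hT1]; noncomm_ring
    by_cases h1' : i.val = m + 1
    · have hAi := hA (m + 1) (by omega) (by omega)
      rw [← h1', hi] at hAi
      have : i + 1 = 0 := by
        rw [← hi, h1', ← hn0]; push_cast; ring
      rw [this, hAi, hA0, h1']
      calc T * (C (m + 1) - 1) = T * C (m + 1) * 1 - T := by noncomm_ring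
        _ = T * C (m + 1) * (T⁻¹ * T) - T := by rw [hT2]
        _ = _ := by noncomm_ring
    · have hAi := hA i.val (by omega) (by omega)
      have hAi1 := hA (i.val + 1) (by omega) (by omega)
      rw [hi] at hAi
      rw [Nat.cast_add, hi, Nat.cast_one] at hAi1
      rw [hAi, hAi1, mul_sub, sub_mul, hTk _ (by omega) (by omega)]
      simp
  have hA1 : A 1 = C 1 - 1 := by
    have := hA 1 le_rfl (by omega)
    rwa [Nat.cast_one] at this
  have hAd : ∀ d : ℕ, 1 ≤ d → d ≤ m → A (1 + (d : ZMod (m + 2))) = C (1 + d) - 1 := by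
    intro d a b
    have := hA (1 + d) (by omega) (by omega)
    rwa [Nat.cast_add, Nat.cast_one] at this
  have hA2 : A (1 + 1) = C (1 + 1) - 1 := by
    have := hAd 1 le_rfl (by omega)
    rwa [Nat.cast_one] at this
  let φ : Matrix (Fin r) (Fin r) ℂ →ₐ[ℂ] Module.End ℂ (Fin r → ℂ) :=
    (Matrix.toLinAlgEquiv' : Matrix (Fin r) (Fin r) ℂ ≃ₐ[ℂ] _).toAlgHom
  have hφ : ∀ M, φ M = M.mulVecLin := fun M => rfl
  have one_A1 : 1 + φ (A 1) = φ (C 1) := by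
    rw [hA1, map_sub, map_one]; abel
  have one_A2 : 1 + φ (A (1 + 1)) = φ (C (1 + 1)) := by
    rw [hA2, map_sub, map_one]; abel
  obtain ⟨x, hx, hxk⟩ := aux_final (m + 2) hn (fun i => φ (A i)) (φ T) (φ T⁻¹)
    (by rw [← map_mul, hT1, map_one]) (by rw [← map_mul, hT2, map_one])
    (by intro i; rw [← map_mul, hTA, map_mul])
    (by
      intro d hd hd'
      have hc := hcomm 1 (1 + d) le_rfl (by omega) (by omega) (by omega) (by omega)
      rw [hAd d (by omega) (by omega), hA1, ← map_mul, ← map_mul]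
      congr 1
      calc (C 1 - 1) * (C (1 + d) - 1) = C 1 * C (1 + d) - C 1 - C (1 + d) + 1 := by noncomm_ring
        _ = _ := by rw [hc]; noncomm_ring)
    (by
      rw [one_A1]
      exact (hinv 1 le_rfl (by omega)).map φ)
    (by
      rw [one_A1, one_A2, ← map_mul, ← map_mul, ← map_mul, ← map_mul,
        hbraid 1 le_rfl (by omega)])
    (by exact hrank)
    (by
      intro i x a b
      have := Submodule.finrank_eq_zero.1 (h0 i)
      have hmem : x ∈ LinearMap.range (A i).mulVecLin ⊓ LinearMap.range (A (i + 1)).mulVecLin :=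
        ⟨a, b⟩
      rw [this] at hmem
      simpa using hmem)
    (by
      intro i d hd hd'
      have hv : ((i + (d : ZMod (m + 2))) - i).val = d := by
        rw [add_sub_cancel_left, ZMod.val_natCast, Nat.mod_eq_of_lt (by omega)]
      have := h1 (i + d) i (by rw [hv]; omega)
      rw [inf_comm] at this
      exact this)
  have hfix : ∀ i, 1 ≤ i → i ≤ m + 2 - 1 → (C i).mulVec x = x := by
    intro i a b
    have h := hxk (i : ZMod (m + 2))
    simp only [hA i a b, hφ, Matrix.mulVecLin_apply, Matrix.sub_mulVec, Matrix.one_mulVec] at h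
    exact sub_eq_zero.1 h
  rcases hirr (Submodule.span ℂ {x}) (by
    intro i a b v hv
    obtain ⟨c, rfl⟩ := Submodule.mem_span_singleton.1 hv
    rw [Matrix.mulVec_smul, hfix i a b]
    exact hv) with h | h
  · exact hx (by simpa using h)
  · have h2 := finrank_span_singleton (K := ℂ) hx
    rw [h, finrank_top] at h2
    simp at h2
    omega
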